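/- Let 𝕏 be any scheme and x, y ⊆ V₃ formula-standards with x ≠ ∅ and y ≠ V₃, and let 𝕃 be the set of all xy-valid inferences over 𝕏. Then T^d(𝕃) = 𝕃⋆, i.e., the dual transitive closure of 𝕃 consists exactly of the inferences whose premise set is an antitheorem of 𝕃 or whose conclusion is a theorem of 𝕃. -/

import Mathlib

namespace ThreeValued

/-- Formulas of the propositional language: countably many variables,
negation, conjunction, disjunction. -/
inductive Fml : Type
  | var : ℕ → Fml
  | neg : Fml → Fml
  | conj : Fml → Fml → Fml
  | disj : Fml → Fml → Fml
deriving DecidableEq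

/-- An inference Γ ⇒ φ: a finite set of premises and a conclusion. -/
structure Infer : Type where
  prem : Finset Fml
  concl : Fml

/-- A set of inferences is closed under transitivity:
whenever there is a nonempty Δ with Δ ⇒ φ ∈ L and Γ ⇒ δ ∈ L for all δ ∈ Δ,
then Γ ⇒ φ ∈ L. -/
def TransClosed (L : Set Infer) : Prop :=
  ∀ (Γ Δ : Finset Fml) (φ : Fml), Δ.Nonempty →
    (⟨Δ, φ⟩ : Infer) ∈ L → (∀ δ ∈ Δ, (⟨Γ, δ⟩ : Infer) ∈ L) → (⟨Γ, φ⟩ : Infer) ∈ L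

/-- The transitive closure of a set of inferences: the least superset closed
under transitivity. -/
def T (L : Set Infer) : Set Infer := ⋂₀ {L' : Set Infer | L ⊆ L' ∧ TransClosed L'}

/-- A set of inferences is open under dual transitivity:
whenever there is a nonempty Δ with Δ ⇒ φ ∉ L and Γ ⇒ δ ∉ L for all δ ∈ Δ,
then Γ ⇒ φ ∉ L. -/
def DualTransClosed (L : Set Infer) : Prop :=
  ∀ (Γ Δ : Finset Fml) (φ : Fml), Δ.Nonempty →
    (⟨Δ, φ⟩ : Infer) ∉ L → (∀ δ ∈ Δ, (⟨Γ, δ⟩ : Infer) ∉ L) → (⟨Γ, φ⟩ : Infer) ∉ L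

/-- The dual transitive closure: the greatest subset open under dual
transitivity. -/
def Td (L : Set Infer) : Set Infer := ⋃₀ {L' : Set Infer | L' ⊆ L ∧ DualTransClosed L'}

/-- The three truth values 0, 1/2, 1. -/
inductive V3 : Type
  | zero | half | one
deriving DecidableEq

/-- A three-valued scheme: a triple of truth functions for ¬, ∧ and ∨. -/
structure Scheme : Type where
  fneg : V3 → V3
  fconj : V3 → V3 → V3
  fdisj : V3 → V3 → V3

/-- Boolean normality: on Boolean inputs the operations agree with the
classical ones. -/
def BooleanNormal (X : Scheme) : Prop :=
  X.fneg .zero = .one ∧ X.fneg .one = .zero ∧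
  X.fconj .one .one = .one ∧ X.fconj .one .zero = .zero ∧
  X.fconj .zero .one = .zero ∧ X.fconj .zero .zero = .zero ∧
  X.fdisj .one .one = .one ∧ X.fdisj .one .zero = .one ∧
  X.fdisj .zero .one = .one ∧ X.fdisj .zero .zero = .zero

/-- The information order: 1/2 is below 0 and below 1. -/
def infLe (a b : V3) : Prop := a = .half ∨ a = b

/-- Monotonicity of a scheme with respect to the information order. -/
def Monotonic (X : Scheme) : Prop :=
  (∀ a b, infLe a b → infLe (X.fneg a) (X.fneg b)) ∧
  (∀ a₁ a₂ b₁ b₂, infLe a₁ b₁ → infLe a₂ b₂ → infLe (X.fconj a₁ a₂) (X.fconj b₁ b₂)) ∧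
  (∀ a₁ a₂ b₁ b₂, infLe a₁ b₁ → infLe a₂ b₂ → infLe (X.fdisj a₁ a₂) (X.fdisj b₁ b₂))

/-- Boolean normal monotonic schemes. -/
def BNM (X : Scheme) : Prop := BooleanNormal X ∧ Monotonic X

/-- Valuations respecting a scheme. -/
def Respects (X : Scheme) (v : Fml → V3) : Prop :=
  (∀ φ, v (.neg φ) = X.fneg (v φ)) ∧
  (∀ φ ψ, v (.conj φ ψ) = X.fconj (v φ) (v ψ)) ∧
  (∀ φ ψ, v (.disj φ ψ) = X.fdisj (v φ) (v ψ))

/-- The strict formula-standard s = {1}. -/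
def sStd : Set V3 := {.one}

/-- The tolerant formula-standard t = {1, 1/2}. -/
def tStd : Set V3 := {.one, .half}

/-- An inference is xy-valid over a scheme X if every valuation respecting X
whose value on each premise is in x gives the conclusion a value in y. -/
def Valid (X : Scheme) (x y : Set V3) (I : Infer) : Prop :=
  ∀ v : Fml → V3, Respects X v → (∀ γ ∈ I.prem, v γ ∈ x) → v I.concl ∈ y

/-- The ss-valid inferences over X. -/
def SS (X : Scheme) : Set Infer := {I | Valid X sStd sStd I}

/-- The tt-valid inferences over X. -/
def TT (X : Scheme) : Set Infer := {I | Valid X tStd tStd I}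

/-- The st-valid inferences over X. -/
def ST (X : Scheme) : Set Infer := {I | Valid X sStd tStd I}

/-- The ts-valid inferences over X. -/
def TS (X : Scheme) : Set Infer := {I | Valid X tStd sStd I}

/-- Classical two-valued valuations. -/
def RespectsCL (v : Fml → Bool) : Prop :=
  (∀ φ, v (.neg φ) = ! v φ) ∧
  (∀ φ ψ, v (.conj φ ψ) = (v φ && v ψ)) ∧
  (∀ φ ψ, v (.disj φ ψ) = (v φ || v ψ))

/-- The classically valid inferences. -/
def CL : Set Infer :=
  {I | ∀ v : Fml → Bool, RespectsCL v → (∀ γ ∈ I.prem, v γ = true) → v I.concl = true}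

/-- Substitution: the homomorphic extension of a map from variables to
formulas. -/
def subst (σ : ℕ → Fml) : Fml → Fml
  | .var n => σ n
  | .neg φ => .neg (subst σ φ)
  | .conj φ ψ => .conj (subst σ φ) (subst σ ψ)
  | .disj φ ψ => .disj (subst σ φ) (subst σ ψ)

/-- Reflexivity. -/
def PropR (L : Set Infer) : Prop := ∀ φ : Fml, (⟨{φ}, φ⟩ : Infer) ∈ L

/-- Monotonicity (weakening). -/
def PropM (L : Set Infer) : Prop :=
  ∀ (Γ Sg : Finset Fml) (φ : Fml), (⟨Γ, φ⟩ : Infer) ∈ L → Γ ⊆ Sg → (⟨Sg, φ⟩ : Infer) ∈ L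

/-- Structurality (closure under substitutions). -/
def PropS (L : Set Infer) : Prop :=
  ∀ (Γ : Finset Fml) (φ : Fml), (⟨Γ, φ⟩ : Infer) ∈ L →
    ∀ σ : ℕ → Fml, (⟨Γ.image (subst σ), subst σ φ⟩ : Infer) ∈ L

/-- The Tarskian closure: the least superset satisfying (R), (M), (T), (S). -/
def Tar (L : Set Infer) : Set Infer :=
  ⋂₀ {L' : Set Infer | L ⊆ L' ∧ PropR L' ∧ PropM L' ∧ TransClosed L' ∧ PropS L'}

/-- L⋆: the inferences whose premise set is an antitheorem of L or whose
conclusion is a theorem of L. -/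
def starL (L : Set Infer) : Set Infer :=
  {I | (∀ ψ : Fml, (⟨I.prem, ψ⟩ : Infer) ∈ L) ∨ (∀ Δ : Finset Fml, (⟨Δ, I.concl⟩ : Infer) ∈ L)}

/-- The propositional variables occurring in a formula. -/
def fvars : Fml → Finset ℕ
  | .var n => {n}
  | .neg φ => fvars φ
  | .conj φ ψ => fvars φ ∪ fvars ψ
  | .disj φ ψ => fvars φ ∪ fvars ψ

/-- The valuation respecting `X` that extends an assignment of values to the variables. -/
def Scheme.eval (X : Scheme) (e : ℕ → V3) : Fml → V3
  | .var n => e n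
  | .neg φ => X.fneg (X.eval e φ)
  | .conj φ ψ => X.fconj (X.eval e φ) (X.eval e ψ)
  | .disj φ ψ => X.fdisj (X.eval e φ) (X.eval e ψ)

theorem Scheme.respects_eval (X : Scheme) (e : ℕ → V3) : Respects X (X.eval e) :=
  ⟨fun _ => rfl, fun _ _ => rfl, fun _ _ => rfl⟩

theorem Respects.eval_eq {X : Scheme} {v : Fml → V3} (hv : Respects X v) {e : ℕ → V3} (φ : Fml)
    (h : ∀ n ∈ fvars φ, e n = v (.var n)) : X.eval e φ = v φ := by
  induction φ with
  | var n => exact h n (by simp [fvars])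
  | neg φ ih => rw [Scheme.eval, hv.1, ih h]
  | conj φ ψ ihφ ihψ =>
    rw [Scheme.eval, hv.2.1, ihφ fun n hn => h n (Finset.mem_union_left _ hn),
      ihψ fun n hn => h n (Finset.mem_union_right _ hn)]
  | disj φ ψ ihφ ihψ =>
    rw [Scheme.eval, hv.2.2, ihφ fun n hn => h n (Finset.mem_union_left _ hn),
      ihψ fun n hn => h n (Finset.mem_union_right _ hn)]

/-- The value of a variable can be reset without changing the formulas in which it does not
occur. -/
theorem Respects.exists_update {X : Scheme} {v : Fml → V3} (hv : Respects X v) (p : ℕ) (a : V3) :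
    ∃ w, Respects X w ∧ w (.var p) = a ∧ ∀ φ, p ∉ fvars φ → w φ = v φ := by
  refine ⟨X.eval (Function.update (fun n => v (.var n)) p a), X.respects_eval _, ?_, ?_⟩
  · simp [Scheme.eval]
  · intro φ hp
    refine hv.eval_eq φ fun n hn => ?_
    rw [Function.update_of_ne]
    rintro rfl
    exact hp hn

theorem starL_subset (L : Set Infer) : starL L ⊆ L := by
  rintro ⟨Γ, φ⟩ (h | h)
  · exact h φ
  · exact h Γ

theorem dualTransClosed_starL (L : Set Infer) : DualTransClosed (starL L) := by
  rintro Γ Δ φ ⟨δ, hδ⟩ hΔ hΓ (h | h)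
  · exact hΓ δ hδ (Or.inl h)
  · exact hΔ (Or.inr h)

theorem starL_subset_Td (L : Set Infer) : starL L ⊆ Td L :=
  Set.subset_sUnion_of_mem ⟨starL_subset L, dualTransClosed_starL L⟩

/-- A variable occurring neither in `Γ` nor in `φ` interpolates between a premise set which is not
an antitheorem and a conclusion which is not a theorem. -/
theorem exists_not_valid_of_notMem_starL {X : Scheme} {x y : Set V3} (hx : x ≠ ∅)
    (hy : y ≠ Set.univ) {Γ : Finset Fml} {φ : Fml}
    (h : (⟨Γ, φ⟩ : Infer) ∉ starL {I | Valid X x y I}) :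
    ∃ δ, ¬ Valid X x y ⟨Γ, δ⟩ ∧ ¬ Valid X x y ⟨{δ}, φ⟩ := by
  obtain ⟨a, ha⟩ := Set.nonempty_iff_ne_empty.mpr hx
  obtain ⟨b, hb⟩ := (Set.ne_univ_iff_exists_notMem y).mp hy
  obtain ⟨p, hp⟩ := Infinite.exists_notMem_finset (Γ.biUnion fvars ∪ fvars φ)
  simp only [Finset.mem_union, Finset.mem_biUnion, not_or, not_exists, not_and] at hp
  simp only [starL, Set.mem_ofPred_eq, not_or, not_forall, Valid] at h
  obtain ⟨⟨_, v, hv, hΓ, -⟩, ⟨_, w, hw, -, hφ⟩⟩ := h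
  obtain ⟨v', hv', hvp, hv'v⟩ := hv.exists_update p b
  obtain ⟨w', hw', hwp, hw'w⟩ := hw.exists_update p a
  refine ⟨.var p, fun hval => hb ?_, fun hval => hφ ?_⟩
  · rw [← hvp]
    exact hval v' hv' fun γ hγ => hv'v γ (hp.1 γ hγ) ▸ hΓ γ hγ
  · rw [← hw'w φ hp.2]
    refine hval w' hw' fun γ hγ => ?_
    rw [Finset.mem_singleton.mp hγ, hwp]
    exact ha

/-- For the set L of xy-valid inferences over any scheme (with x ≠ ∅ and
y ≠ V₃), the dual transitive closure of L is exactly L⋆. -/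
theorem stmt13 : ∀ (X : Scheme) (x y : Set V3), x ≠ ∅ → y ≠ Set.univ →
    Td {I : Infer | Valid X x y I} = starL {I : Infer | Valid X x y I} := by
  intro X x y hx hy
  refine Set.Subset.antisymm ?_ (starL_subset_Td _)
  rintro ⟨Γ, φ⟩ ⟨L', ⟨hL', hclosed⟩, hmem⟩
  by_contra hstar
  obtain ⟨δ, hΓ, hφ⟩ := exists_not_valid_of_notMem_starL hx hy hstar
  refine hclosed Γ {δ} φ (Finset.singleton_nonempty δ) (fun h => hφ (hL' h)) ?_ hmem
  intro ε hε h
  rw [Finset.mem_singleton.mp hε] at h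
  exact hΓ (hL' h)

end ThreeValued
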